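/- Let J be a set of perfect trees closed under restrictions (if T ∈ J and s ∈ T then T↾s ∈ J). Let A ⊆ J be an antichain in the forcing sense: for distinct S, S' ∈ A there is no T ∈ J with T ⊆ S ∩ S'. Let B ⊆ A and suppose that for every T ∈ A there is T'' ∈ J with T'' ⊆ T such that [T''] is covered by a finite subset of B with pairwise disjoint branch sets (i.e. there is a finite C ⊆ B with [S] ∩ [S'] = ∅ for distinct S, S' ∈ C and [T''] ⊆ ⋃_{S∈C} [S]). Then A = B; in particular, if B is countable then A is countable. -/

import Mathlib

open Set

/-- A tree on binary strings: a set of finite binary strings closed under initial segments. -/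
def IsTree (T : Set (List Bool)) : Prop :=
  ∀ ⦃s t : List Bool⦄, s <+: t → t ∈ T → s ∈ T

/-- The restriction `T↾s = {t ∈ T : s ⊆ t ∨ t ⊆ s}`. -/
def restr (T : Set (List Bool)) (s : List Bool) : Set (List Bool) :=
  {t ∈ T | s <+: t ∨ t <+: s}

/-- A perfect tree: a nonempty tree with no endpoints and no isolated branches, i.e.
every node extends to a branching node. -/
def IsPerfect (T : Set (List Bool)) : Prop :=
  IsTree T ∧ T.Nonempty ∧
    ∀ s ∈ T, ∃ t ∈ T, s <+: t ∧ t ++ [false] ∈ T ∧ t ++ [true] ∈ T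

/-- The initial segment `a↾n` of an infinite binary sequence. -/
def seg (a : ℕ → Bool) (n : ℕ) : List Bool := (List.range n).map a

/-- The initial segment `b↾n` of an element of Baire space. -/
def segN (b : ℕ → ℕ) (n : ℕ) : List ℕ := (List.range n).map b

/-- The branch set `[T] = {a ∈ 2^ℕ : ∀ n, a↾n ∈ T}`. -/
def branches (T : Set (List Bool)) : Set (ℕ → Bool) := {a | ∀ n, seg a n ∈ T}

/-- The inclusion `ι : 2^ℕ → ℕ^ℕ` induced by `{0,1} ⊆ ℕ`. -/
def iota (a : ℕ → Bool) : ℕ → ℕ := fun n => (a n).toNat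

/-- `r` is the root of `T`: the largest string with `T↾r = T`. -/
def IsRoot (T : Set (List Bool)) (r : List Bool) : Prop :=
  r ∈ T ∧ restr T r = T ∧ ∀ s ∈ T, restr T s = T → s <+: r

/-- The root of a (perfect) tree, via choice. -/
noncomputable def root (T : Set (List Bool)) : List Bool :=
  Classical.epsilon fun r => IsRoot T r

/-- `T⇂i = T↾(roo(T)⌢i)`. -/
noncomputable def splitOne (T : Set (List Bool)) (i : Bool) : Set (List Bool) :=
  restr T (root T ++ [i])

/-- Iterated splitting `T⇂s`, with `T⇂Λ = T` and `T⇂(s⌢i) = (T⇂s)⇂i`. -/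
noncomputable def splitAt (T : Set (List Bool)) (s : List Bool) : Set (List Bool) :=
  s.foldl splitOne T

/-- A splitting system: perfect trees `T_s` with `T_{s⌢i} ⊆ T_s⇂i`. -/
def IsSplittingSystem (Tf : List Bool → Set (List Bool)) : Prop :=
  (∀ s, IsPerfect (Tf s)) ∧ ∀ (s : List Bool) (i : Bool), Tf (s ++ [i]) ⊆ splitOne (Tf s) i

/-- `S` is clopen in `T`: `S = ⋃_{s∈A} T↾s` for some finite `A ⊆ T`. -/
def ClopenIn (S T : Set (List Bool)) : Prop :=
  ∃ A : Set (List Bool), A.Finite ∧ A ⊆ T ∧ S = ⋃ s ∈ A, restr T s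

/-- Functional perfect trees: codes for continuous functions `2^ℕ → ℕ^ℕ`. -/
def IsFPT (c : Set (List Bool × List ℕ)) : Prop :=
  (∀ p ∈ c, p.1.length = p.2.length) ∧
  (∀ p ∈ c, ∀ n ≤ p.1.length, (p.1.take n, p.2.take n) ∈ c) ∧
  (∀ s : List Bool, ∃ u : List ℕ, (s, u) ∈ c) ∧
  (∀ p ∈ c, ∀ i : Bool, ∃ k : ℕ, (p.1 ++ [i], p.2 ++ [k]) ∈ c) ∧
  (∀ m : ℕ, ∃ k, m ≤ k ∧ ∀ s : List Bool, s.length = k →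
      ∃ us : List ℕ, us.length = m ∧ ∀ u : List ℕ, (s, u) ∈ c → us <+: u)

/-- The code `cod(F) = {(a↾n, F(a)↾n) : a ∈ 2^ℕ, n ∈ ℕ}` of a function `F`. -/
def cod (F : (ℕ → Bool) → ℕ → ℕ) : Set (List Bool × List ℕ) :=
  {p | ∃ (a : ℕ → Bool) (n : ℕ), p = (seg a n, segN (F a) n)}

/-- The relation `f_c` coded by `c`. -/
def fc (c : Set (List Bool × List ℕ)) : Set ((ℕ → Bool) × (ℕ → ℕ)) :=
  {q | ∀ m, (seg q.1 m, segN q.2 m) ∈ c}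

theorem exists_branch {T : Set (List Bool)} (hT : IsPerfect T) {s : List Bool} (hs : s ∈ T) :
    ∃ a ∈ branches T, ∃ n, seg a n = s := by
  obtain ⟨htree, -, hsp⟩ := hT
  have hext : ∀ s : List Bool, ∃ i : Bool, s ∈ T → s ++ [i] ∈ T := by
    intro s
    by_cases h : s ∈ T
    · obtain ⟨t, ht, ⟨r, rfl⟩, h0, -⟩ := hsp s h
      cases r with
      | nil => exact ⟨false, fun _ => by simpa using h0⟩
      | cons b r => exact ⟨b, fun _ => htree ⟨r, by simp⟩ ht⟩
    · exact ⟨false, fun h' => absurd h' h⟩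
  choose f hf using hext
  let u : ℕ → List Bool := fun n => Nat.rec s (fun _ v => v ++ [f v]) n
  have u0 : u 0 = s := rfl
  have us : ∀ n, u (n+1) = u n ++ [f (u n)] := fun n => rfl
  clear_value u
  have huT : ∀ n, u n ∈ T := by
    intro n
    induction n with
    | zero => rw [u0]; exact hs
    | succ n ih => rw [us]; exact hf _ ih
  have hlen : ∀ n, (u n).length = s.length + n := by
    intro n
    induction n with
    | zero => simp [u0]
    | succ n ih => rw [us]; simp [ih]; omega
  have hpre : ∀ m k, u m <+: u (m + k) := by
    intro m k
    induction k with
    | zero => simp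
    | succ k ih => exact ih.trans (by rw [← Nat.add_assoc, us]; exact List.prefix_append _ _)
  have hseg : ∀ n, seg (fun n => (u (n+1)).getD n false) n = (u n).take n := by
    intro n
    apply List.ext_getElem
    · simp [seg, hlen]
    · intro i h1 h2
      have hi : i < n := by simpa [seg] using h1
      have hp := hpre (i+1) (n - (i+1))
      rw [show i + 1 + (n - (i+1)) = n by omega] at hp
      have hl : i < (u (i+1)).length := by rw [hlen]; omega
      simp only [seg, List.getElem_map, List.getElem_range, List.getElem_take]
      rw [List.getD_eq_getElem _ _ hl]
      exact hp.getElem hl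
  refine ⟨fun n => (u (n+1)).getD n false, fun n => ?_, s.length, ?_⟩
  · rw [hseg]; exact htree (List.take_prefix _ _) (huT n)
  · have hp := hpre 0 s.length
    rw [Nat.zero_add, u0] at hp
    rw [hseg]; exact (List.prefix_iff_eq_take.1 hp).symm

theorem exists_avoid {T : Set (List Bool)} (hT : IsPerfect T) {C : Set (Set (List Bool))}
    (hC : C.Finite) (htree : ∀ S ∈ C, IsTree S)
    (hno : ∀ S ∈ C, ∀ s ∈ T, ¬ restr T s ⊆ S) : ∃ s ∈ T, ∀ S ∈ C, s ∉ S := by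
  induction C, hC using Set.Finite.induction_on with
  | empty => exact ⟨hT.2.1.some, hT.2.1.some_mem, by simp⟩
  | @insert S C _ _ ih =>
    obtain ⟨s, hs, hsC⟩ := ih (fun S h => htree S (Or.inr h)) (fun S h => hno S (Or.inr h))
    obtain ⟨t, ⟨htT, ht⟩, htS⟩ := Set.not_subset.1 (hno S (Or.inl rfl) s hs)
    rcases ht with ht | ht
    · refine ⟨t, htT, ?_⟩
      rintro S' (rfl | h)
      · exact htS
      · exact fun h' => hsC S' h (htree S' (Or.inr h) ht h')
    · refine ⟨s, hs, ?_⟩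
      rintro S' (rfl | h)
      · exact fun h' => htS (htree _ (Or.inl rfl) ht h')
      · exact hsC S' h

/-- Combinatorial core of the CCC lemma: if every member of an antichain `A ⊆ J` has
a subtree in `J` finitely covered, with disjoint pieces, by members of `B ⊆ A`, then
`A = B`; in particular `A` is countable whenever `B` is. -/
theorem stmt_16 (J : Set (Set (List Bool)))
    (hJperf : ∀ T ∈ J, IsPerfect T)
    (hJrestr : ∀ T ∈ J, ∀ s ∈ T, restr T s ∈ J)
    (A B : Set (Set (List Bool))) (hAJ : A ⊆ J)
    (hanti : ∀ S ∈ A, ∀ S' ∈ A, S ≠ S' → ¬∃ T ∈ J, T ⊆ S ∩ S')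
    (hBA : B ⊆ A)
    (hcov : ∀ T ∈ A, ∃ T'' ∈ J, T'' ⊆ T ∧
      ∃ C : Set (Set (List Bool)), C.Finite ∧ C ⊆ B ∧
        (∀ S ∈ C, ∀ S' ∈ C, S ≠ S' → branches S ∩ branches S' = ∅) ∧
        branches T'' ⊆ ⋃ S ∈ C, branches S) :
    A = B ∧ (B.Countable → A.Countable) := by
  have hAB : A = B := by
    refine Set.Subset.antisymm ?_ hBA
    intro T hT
    obtain ⟨T2, hT2J, hT2T, C, hCfin, hCB, -, hcover⟩ := hcov T hT
    have key : ∃ S ∈ C, ∃ s ∈ T2, restr T2 s ⊆ S := by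
      by_contra hcon
      push Not at hcon
      obtain ⟨s, hs, hsC⟩ := exists_avoid (hJperf _ hT2J) hCfin
        (fun S hS => (hJperf S (hAJ (hBA (hCB hS)))).1) hcon
      obtain ⟨a, ha, n, hn⟩ := exists_branch (hJperf _ hT2J) hs
      obtain ⟨S, hS, haS⟩ := Set.mem_iUnion₂.1 (hcover ha)
      exact hsC S hS (hn ▸ haS n)
    obtain ⟨S, hS, s, hs, hsub⟩ := key
    by_cases hTS : T = S
    · rw [hTS]; exact hCB hS
    · exact absurd ⟨restr T2 s, hJrestr _ hT2J s hs,
        fun t ht => ⟨hT2T ht.1, hsub ht⟩⟩ (hanti T hT S (hBA (hCB hS)) hTS)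
  exact ⟨hAB, fun h => hAB ▸ h⟩
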